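/- Define t̂(u) = u³(u+2)/(2u+1) and ŷ(u) = u(2u+1)/(u+2) for u ∈ ℂ with (2u+1)(u+2) ≠ 0. Let u₀ ∈ ℂ be such that t̂'(u₀) ≠ 0, t̂(u₀) ∉ {0,1}, and ŷ(u₀) ∉ {0, 1, t̂(u₀)}. Suppose V is an open neighbourhood of u₀ and Y is a function, twice differentiable on an open neighbourhood of t̂(u₀), such that Y(t̂(u)) = ŷ(u) for all u ∈ V, with t̂(u) ∉ {0,1} and Y(t̂(u)) ∉ {0,1,t̂(u)} for u ∈ V. Then Y is a solution of P_VI(0, 1, 1, 1; t̂) on a neighbourhood of t̂(u₀). -/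

import Mathlib

/-- The right-hand side of the sixth Painlevé equation with local monodromy
differences `θ0, θ1, θt, θinf` (via `α = (θ∞−1)²/2`, `β = −θ₀²/2`,
`γ = θ₁²/2`, `δ = (1−θ_t²)/2`), evaluated on the function `y` at the point `t`. -/
noncomputable def pviRHS (θ0 θ1 θt θinf : ℂ) (y : ℂ → ℂ) (t : ℂ) : ℂ :=
  (1/2) * (1/(y t) + 1/(y t - 1) + 1/(y t - t)) * (deriv y t)^2
    - (1/t + 1/(t-1) + 1/(y t - t)) * deriv y t
    + (y t * (y t - 1) * (y t - t) / (t^2 * (t-1)^2)) *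
      ((θinf - 1)^2/2 + (-(θ0^2/2)) * t/(y t)^2 + (θ1^2/2) * (t-1)/(y t - 1)^2
        + ((1 - θt^2)/2) * (t*(t-1))/(y t - t)^2)

/-- `y` satisfies the sixth Painlevé equation `P_VI(θ0,θ1,θt,θinf)` at the point `t`. -/
def PVIAt (θ0 θ1 θt θinf : ℂ) (y : ℂ → ℂ) (t : ℂ) : Prop :=
  deriv (deriv y) t = pviRHS θ0 θ1 θt θinf y t

/-- `y` is a solution of the sixth Painlevé equation `P_VI(θ0,θ1,θt,θinf;t)` on the
open set `U ⊆ ℂ`: `U` is open, `t ∉ {0,1}` and `y t ∉ {0,1,t}` on `U`, `y` is twice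
differentiable on `U`, and the Painlevé VI equation holds at every point of `U`. -/
def IsPVISolutionOn (θ0 θ1 θt θinf : ℂ) (y : ℂ → ℂ) (U : Set ℂ) : Prop :=
  IsOpen U ∧
  (∀ t ∈ U, t ≠ 0 ∧ t ≠ 1 ∧ y t ≠ 0 ∧ y t ≠ 1 ∧ y t ≠ t) ∧
  (∀ t ∈ U, DifferentiableAt ℂ y t ∧ DifferentiableAt ℂ (deriv y) t) ∧
  (∀ t ∈ U, PVIAt θ0 θ1 θt θinf y t)

/-- The denominator `Z(t)` appearing in the Okamoto transformation. -/
noncomputable def okZ (ν0 ν1 νt : ℂ) (y : ℂ → ℂ) (t : ℂ) : ℂ :=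
  ((t-1) * deriv y t - ν0) / (y t)
    - (t * deriv y t + ν1) / (y t - 1)
    + (deriv y t - 1 - νt) / (y t - t)

/-- The Okamoto operator `K_{[ν0,ν1,νt,νinf;t]} y = y + (ν0+ν1+νt+νinf)/Z`. -/
noncomputable def okK (ν0 ν1 νt νinf : ℂ) (y : ℂ → ℂ) (t : ℂ) : ℂ :=
  y t + (ν0 + ν1 + νt + νinf) / okZ ν0 ν1 νt y t

/-- first derivative of `Y` in the parameter `u` -/
noncomputable def hitchinP (u : ℂ) : ℂ :=
  (u^2+4*u+1)*(2*u+1)^2/(3*u^2*(u+1)^2*(u+2)^2)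

lemma hitchin_t_deriv (u : ℂ) (h1 : 2*u+1 ≠ 0) :
    HasStrictDerivAt (fun u : ℂ => u^3*(u+2)/(2*u+1)) (6*u^2*(u+1)^2/(2*u+1)^2) u := by
  have hi := hasStrictDerivAt_id u
  have h := ((hi.pow 3).mul (hi.add_const 2)).div ((hi.const_mul 2).add_const 1) h1
  have h1' : u*2+1 ≠ 0 := by rwa [mul_comm]
  refine h.congr_deriv ?_
  simp only [id, Pi.mul_apply, Pi.pow_apply, Pi.add_apply]
  field_simp
  norm_num
  ring

lemma hitchin_y_deriv (u : ℂ) (h2 : u+2 ≠ 0) :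
    HasDerivAt (fun u : ℂ => u*(2*u+1)/(u+2)) (2*(u^2+4*u+1)/(u+2)^2) u := by
  have hi := hasDerivAt_id u
  have h := (hi.mul ((hi.const_mul 2).add_const 1)).div (hi.add_const 2) h2
  refine h.congr_deriv ?_
  simp only [id, Pi.mul_apply, Pi.pow_apply, Pi.add_apply]
  field_simp
  ring

lemma hitchin_p_deriv (u : ℂ) (h0 : u ≠ 0) (h1 : u+1 ≠ 0) (h2 : u+2 ≠ 0) :
    HasDerivAt hitchinP
      ((((2*u+4)*(2*u+1)^2+(u^2+4*u+1)*(4*(2*u+1)))*(u*(u+1)*(u+2))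
        - (u^2+4*u+1)*(2*u+1)^2*2*(3*u^2+6*u+2))/(3*u^3*(u+1)^3*(u+2)^3)) u := by
  have hi := hasDerivAt_id u
  have hn := (((hi.pow 2).add (hi.const_mul 4)).add_const 1).mul
    (((hi.const_mul 2).add_const 1).pow 2)
  have hd := (((hi.pow 2).const_mul 3).mul ((hi.add_const 1).pow 2)).mul ((hi.add_const 2).pow 2)
  have h := hn.div hd (by simp [h0, h1, h2])
  refine h.congr_deriv ?_
  simp only [id, Pi.mul_apply, Pi.pow_apply, Pi.add_apply]
  field_simp
  norm_num
  ring

lemma hitchin_alg (u t y p q : ℂ) (h0 : u ≠ 0) (h1 : u+1 ≠ 0) (h2 : u+2 ≠ 0) (h3 : 2*u+1 ≠ 0)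
    (h4 : u-1 ≠ 0) (h5 : u^2+4*u+1 ≠ 0)
    (ht : t = u^3*(u+2)/(2*u+1)) (hy : y = u*(2*u+1)/(u+2))
    (hp : p = (u^2+4*u+1)*(2*u+1)^2/(3*u^2*(u+1)^2*(u+2)^2))
    (hq : q * (6*u^2*(u+1)^2/(2*u+1)^2) =
      (((2*u+4)*(2*u+1)^2+(u^2+4*u+1)*(4*(2*u+1)))*(u*(u+1)*(u+2))
        - (u^2+4*u+1)*(2*u+1)^2*2*(3*u^2+6*u+2))/(3*u^3*(u+1)^3*(u+2)^3)) :
    q = (1/2) * (1/y + 1/(y - 1) + 1/(y - t)) * p^2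
    - (1/t + 1/(t-1) + 1/(y - t)) * p
    + (y * (y - 1) * (y - t) / (t^2 * (t-1)^2)) *
      (((1:ℂ) - 1)^2/2 + (-((0:ℂ)^2/2)) * t/y^2 + ((1:ℂ)^2/2) * (t-1)/(y - 1)^2
        + ((1 - (1:ℂ)^2)/2) * (t*(t-1))/(y - t)^2) := by
  have h3' : u*2+1 ≠ 0 := by rwa [mul_comm]
  have h5' : u*(u+4)+1 ≠ 0 := by convert h5 using 1; ring
  have e1 : t - 1 = (u-1)*(u+1)^3/(2*u+1) := by rw [ht]; field_simp; ring
  have e2 : y - 1 = 2*(u-1)*(u+1)/(u+2) := by rw [hy]; field_simp; ring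
  have e3 : y - t = -u*(u-1)*(u+1)*(u^2+4*u+1)/((u+2)*(2*u+1)) := by
    rw [hy, ht]; field_simp; ring
  have hq2 : q = (((2*u+4)*(2*u+1)^2+(u^2+4*u+1)*(4*(2*u+1)))*(u*(u+1)*(u+2))
        - (u^2+4*u+1)*(2*u+1)^2*2*(3*u^2+6*u+2))/(3*u^3*(u+1)^3*(u+2)^3)
        / (6*u^2*(u+1)^2/(2*u+1)^2) := by
    rw [← hq]; field_simp
  rw [hq2, e1, e2, e3, hp, hy, ht]
  simp only [sub_self, zero_pow, ne_eq, OfNat.ofNat_ne_zero, not_false_eq_true, zero_div, neg_zero,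
    zero_mul, one_pow, zero_add, add_zero]
  field_simp
  ring

/-- The quadratic-transformed Hitchin solution `ŷ = u(2u+1)/(u+2)`,
`t̂ = u³(u+2)/(2u+1)` of `P_VI(0,1,1,1;t̂)`. -/
theorem hitchin_transformed_solution
    (that yhat : ℂ → ℂ)
    (hthat : ∀ u, that u = u^3*(u+2)/(2*u+1))
    (hyhat : ∀ u, yhat u = u*(2*u+1)/(u+2))
    (u₀ : ℂ) (hu₀ : (2*u₀+1)*(u₀+2) ≠ 0)
    (hder : deriv that u₀ ≠ 0)
    (ht0 : that u₀ ≠ 0) (ht1 : that u₀ ≠ 1)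
    (hy0 : yhat u₀ ≠ 0) (hy1 : yhat u₀ ≠ 1) (hyt : yhat u₀ ≠ that u₀)
    (V : Set ℂ) (hVopen : IsOpen V) (hu₀V : u₀ ∈ V)
    (Y : ℂ → ℂ) (W : Set ℂ) (hWopen : IsOpen W) (hW : that u₀ ∈ W)
    (hYdiff : ∀ T ∈ W, DifferentiableAt ℂ Y T ∧ DifferentiableAt ℂ (deriv Y) T)
    (hYeq : ∀ u ∈ V, Y (that u) = yhat u)
    (havoid : ∀ u ∈ V, that u ≠ 0 ∧ that u ≠ 1 ∧
      Y (that u) ≠ 0 ∧ Y (that u) ≠ 1 ∧ Y (that u) ≠ that u) :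
    ∃ W' : Set ℂ, IsOpen W' ∧ that u₀ ∈ W' ∧
      IsPVISolutionOn 0 1 1 1 Y W' := by
  have hthat' : that = fun u : ℂ => u^3*(u+2)/(2*u+1) := funext hthat
  have hyhat' : yhat = fun u : ℂ => u*(2*u+1)/(u+2) := funext hyhat
  have hs : ∀ u, 2*u+1 ≠ 0 → HasStrictDerivAt that (6*u^2*(u+1)^2/(2*u+1)^2) u := by
    intro u hu; rw [hthat']; exact hitchin_t_deriv u hu
  have ha : 2*u₀+1 ≠ 0 := left_ne_zero_of_mul hu₀
  have hb : u₀+2 ≠ 0 := right_ne_zero_of_mul hu₀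
  -- the good parameters
  have hG : ∀ᶠ u in nhds u₀, u ∈ V ∧ that u ∈ W ∧ 2*u+1 ≠ 0 ∧ u+2 ≠ 0 := by
    have c1 : ContinuousAt (fun u : ℂ => 2*u+1) u₀ := by fun_prop
    have c2 : ContinuousAt (fun u : ℂ => u+2) u₀ := by fun_prop
    filter_upwards [hVopen.mem_nhds hu₀V,
      (hs u₀ ha).hasDerivAt.continuousAt.preimage_mem_nhds (hWopen.mem_nhds hW),
      c1.eventually_ne ha, c2.eventually_ne hb] with u a b c d
    exact ⟨a, b, c, d⟩
  obtain ⟨N, hN, hNo, hNu⟩ := eventually_nhds_iff.1 hG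
  have hnz : ∀ u ∈ N, u ≠ 0 ∧ u+1 ≠ 0 ∧ u-1 ≠ 0 ∧ u^2+4*u+1 ≠ 0 := by
    intro u hu
    obtain ⟨hV, -, h1, h2⟩ := hN u hu
    obtain ⟨t0, t1, y0, y1, yt⟩ := havoid u hV
    rw [hYeq u hV, hyhat] at y0 y1 yt
    rw [hthat] at t0 t1 yt
    refine ⟨?_, ?_, ?_, ?_⟩
    · rintro rfl; simp at t0
    · intro h
      apply t1
      rw [div_eq_one_iff_eq h1]
      linear_combination (u-1)*(u+1)^2*h
    · intro h
      apply t1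
      rw [div_eq_one_iff_eq h1]
      linear_combination (u+1)^3*h
    · intro h
      apply yt
      rw [div_eq_div_iff h2 h1]
      linear_combination u*(1-u^2)*h
  have hd0 : ∀ u ∈ N, 6*u^2*(u+1)^2/(2*u+1)^2 ≠ 0 := by
    intro u hu
    obtain ⟨a, b, -, -⟩ := hnz u hu
    obtain ⟨-, -, h1, -⟩ := hN u hu
    simp [a, b, h1]
  have hY1 : ∀ u ∈ N, deriv Y (that u) = hitchinP u := by
    intro u hu
    obtain ⟨hV, hWu, h1, h2⟩ := hN u hu
    obtain ⟨a, b, -, -⟩ := hnz u hu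
    have h1' : u*2+1 ≠ 0 := by rwa [mul_comm]
    have hc := (hYdiff _ hWu).1.hasDerivAt.comp u (hs u h1).hasDerivAt
    have hy : HasDerivAt yhat (2*(u^2+4*u+1)/(u+2)^2) u := by
      rw [hyhat']; exact hitchin_y_deriv u h2
    have he : (Y ∘ that) =ᶠ[nhds u] yhat := by
      filter_upwards [hVopen.mem_nhds hV] with v hv using hYeq v hv
    have := (hc.congr_of_eventuallyEq he.symm).unique hy
    rw [← mul_left_inj' (hd0 u hu), this, hitchinP]
    field_simp
    ring
  have hmap : Set.image that N ∈ nhds (that u₀) := by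
    rw [← (hs u₀ ha).map_nhds_eq (hd0 u₀ hNu)]
    exact Filter.image_mem_map (hNo.mem_nhds hNu)
  have hint : ∀ T ∈ interior (Set.image that N), ∃ u ∈ N, that u = T := by
    intro T hT
    have h : T ∈ Set.image that N := interior_subset hT
    exact h
  refine ⟨interior (Set.image that N), isOpen_interior, mem_interior_iff_mem_nhds.2 hmap,
    isOpen_interior, ?_, ?_, ?_⟩
  · intro T hT
    obtain ⟨u, hu, rfl⟩ := hint T hT
    exact havoid u (hN u hu).1
  · intro T hT
    obtain ⟨u, hu, rfl⟩ := hint T hT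
    exact hYdiff _ (hN u hu).2.1
  · intro T hT
    obtain ⟨u, hu, rfl⟩ := hint T hT
    obtain ⟨hV, hWu, h1, h2⟩ := hN u hu
    obtain ⟨a, b, c, d⟩ := hnz u hu
    have hc := (hYdiff _ hWu).2.hasDerivAt.comp u (hs u h1).hasDerivAt
    have he : (deriv Y ∘ that) =ᶠ[nhds u] hitchinP := by
      filter_upwards [hNo.mem_nhds hu] with v hv using hY1 v hv
    have hq := (hc.congr_of_eventuallyEq he.symm).unique (hitchin_p_deriv u a b h2)
    exact hitchin_alg u (that u) (Y (that u)) (deriv Y (that u)) _ a b h2 h1 c d (hthat u)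
      ((hYeq u hV).trans (hyhat u)) (hY1 u hu) hq
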